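/- There exist constants C > 0 and β₀ > 0 such that for all β ≥ β₀, |Δ(β) − 2{1 − |sin(2πβ)/(2πβ)|}| ≤ C/β², where Δ(β) = inf_{R∈Ω_β} M(R) is the value of the two-delta extremal problem for the pair correlation measure. -/

import Mathlib

open Filter MeasureTheory Real Complex

/-- The pair correlation density `1 - (sin πx / (πx))²`. -/
noncomputable def pairCorKernel (x : ℝ) : ℝ := 1 - (Real.sin (π * x) / (π * x)) ^ 2

/-- An entire function has exponential type at most `τ`. -/
def HasExpTypeLE (F : ℂ → ℂ) (τ : ℝ) : Prop :=
  ∀ ε > 0, ∃ C > 0, ∀ z : ℂ, ‖F z‖ ≤ C * Real.exp ((τ + ε) * ‖z‖)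

/-- A function `R : ℝ → ℝ` is admissible if it is integrable and extends to an entire
function of exponential type at most `2π`. -/
def IsAdmissible (R : ℝ → ℝ) : Prop :=
  Integrable R ∧
    ∃ F : ℂ → ℂ, Differentiable ℂ F ∧ HasExpTypeLE F (2 * π) ∧ ∀ x : ℝ, F x = (R x : ℂ)

/-- `M(R) = ∫ R(x) {1 - (sin πx/(πx))²} dx`. -/
noncomputable def Mpc (R : ℝ → ℝ) : ℝ := ∫ x : ℝ, R x * pairCorKernel x

/-- The class `Ω_β` of nonnegative admissible functions with `R(±β) ≥ 1`. -/
def OmegaClass (β : ℝ) : Set (ℝ → ℝ) :=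
  {R | IsAdmissible R ∧ (∀ x : ℝ, 0 ≤ R x) ∧ 1 ≤ R β ∧ 1 ≤ R (-β)}

/-- `Δ(β)`, the value of the two-delta extremal problem for the pair correlation measure. -/
noncomputable def twoDelta (β : ℝ) : ℝ := sInf (Mpc '' OmegaClass β)


/-- A bounded analytic function on the upper half-plane cannot have two different limits
along the two real directions. -/
lemma limits_eq_of_bounded {P : ℂ → ℂ} (hP : Differentiable ℂ P) {C : ℝ}
    (hC : ∀ z : ℂ, 0 ≤ z.im → ‖P z‖ ≤ C) {a b : ℂ}
    (ha : Tendsto (fun x : ℝ => P x) atTop (nhds a))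
    (hb : Tendsto (fun x : ℝ => P x) atBot (nhds b)) : a = b := by
  have hC0 : 0 ≤ C := (norm_nonneg _).trans (hC 0 (by simp))
  have key : ∀ ε > 0, ‖a - b‖ ≤ 3 * ε := by
    intro ε hε
    have h1 : ∀ᶠ x : ℝ in atTop, ‖P ((Real.exp x : ℝ) : ℂ) - a‖ ≤ ε := by
      have := (ha.comp Real.tendsto_exp_atTop).eventually (Metric.closedBall_mem_nhds a hε)
      filter_upwards [this] with x hx
      simpa [dist_eq_norm] using hx
    have h2 : ∀ᶠ x : ℝ in atTop, ‖P ((-Real.exp x : ℝ) : ℂ) - b‖ ≤ ε := by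
      have := (hb.comp (tendsto_neg_atTop_atBot.comp Real.tendsto_exp_atTop)).eventually
        (Metric.closedBall_mem_nhds b hε)
      filter_upwards [this] with x hx
      simpa [dist_eq_norm] using hx
    obtain ⟨s, hs⟩ := eventually_atTop.1 (h1.and h2)
    set L : ℝ := 2 * π * C / ε + 1 with hL
    have hLpos : 0 < L := by positivity
    have hf : Differentiable ℂ (fun w : ℂ => P (cexp w)) := hP.comp Complex.differentiable_exp
    have hrect := Complex.integral_boundary_rect_eq_zero_of_differentiableOn
      (fun w : ℂ => P (cexp w)) (s : ℂ) ((s + L : ℝ) + π * I : ℂ) hf.differentiableOn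
    have e1 : ((s + L : ℝ) + π * I : ℂ).re = s + L := by simp
    have e2 : ((s + L : ℝ) + π * I : ℂ).im = π := by simp
    rw [e1, e2, Complex.ofReal_re, Complex.ofReal_im] at hrect
    have hcont : Continuous P := hP.continuous
    have b1 : ‖(∫ x : ℝ in s..(s + L), P (cexp (x + (0 : ℝ) * I))) - L * a‖ ≤ ε * L := by
      have : (L : ℂ) * a = ∫ x : ℝ in s..(s + L), a := by simp
      rw [this, ← intervalIntegral.integral_sub]
      · have := intervalIntegral.norm_integral_le_of_norm_le_const (a := s) (b := s + L) (C := ε)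
          (f := fun x : ℝ => P (cexp (x + (0 : ℝ) * I)) - a) (by
            intro x hx
            rw [Set.uIoc_of_le (by linarith)] at hx
            have := (hs x hx.1.le).1
            simpa using this)
        simpa [abs_of_pos hLpos] using this
      · apply Continuous.intervalIntegrable; fun_prop
      · apply Continuous.intervalIntegrable; fun_prop
    have b2 : ‖(∫ x : ℝ in s..(s + L), P (cexp (x + (π : ℝ) * I))) - L * b‖ ≤ ε * L := by
      have : (L : ℂ) * b = ∫ x : ℝ in s..(s + L), b := by simp
      rw [this, ← intervalIntegral.integral_sub]
      · have := intervalIntegral.norm_integral_le_of_norm_le_const (a := s) (b := s + L) (C := ε)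
          (f := fun x : ℝ => P (cexp (x + (π : ℝ) * I)) - b) (by
            intro x hx
            rw [Set.uIoc_of_le (by linarith)] at hx
            have := (hs x hx.1.le).2
            simpa [Complex.exp_add, Complex.exp_pi_mul_I] using this)
        simpa [abs_of_pos hLpos] using this
      · apply Continuous.intervalIntegrable; fun_prop
      · apply Continuous.intervalIntegrable; fun_prop
    have bs : ∀ t : ℝ, ‖∫ y : ℝ in (0 : ℝ)..π, P (cexp (t + y * I))‖ ≤ C * π := by
      intro t
      have := intervalIntegral.norm_integral_le_of_norm_le_const (a := 0) (b := π) (C := C)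
          (f := fun y : ℝ => P (cexp (t + y * I))) (by
            intro y hy
            rw [Set.uIoc_of_le pi_pos.le] at hy
            apply hC
            rw [Complex.exp_im]
            simp only [Complex.add_im, Complex.ofReal_im, Complex.mul_im, Complex.ofReal_re,
              Complex.I_im, Complex.I_re, mul_one, mul_zero, add_zero, zero_add]
            exact mul_nonneg (Real.exp_pos _).le (Real.sin_nonneg_of_nonneg_of_le_pi hy.1.le hy.2))
      simpa [abs_of_pos pi_pos] using this
    have c1 := bs s
    have c2 := bs (s + L)
    generalize (∫ x : ℝ in s..(s + L), P (cexp (x + (0 : ℝ) * I))) = i1 at *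
    generalize (∫ x : ℝ in s..(s + L), P (cexp (x + (π : ℝ) * I))) = i2 at *
    generalize (∫ y : ℝ in (0 : ℝ)..π, P (cexp (s + y * I))) = i3 at *
    generalize (∫ y : ℝ in (0 : ℝ)..π, P (cexp ((s + L : ℝ) + y * I))) = i4 at *
    have hab : (L : ℂ) * (a - b) = -(i1 - L * a) + (i2 - L * b) - I * i4 + I * i3 := by
      simp only [smul_eq_mul] at hrect
      linear_combination hrect
    have hn : L * ‖a - b‖ ≤ ε * L + ε * L + C * π + C * π := by
      have : L * ‖a - b‖ = ‖(L : ℂ) * (a - b)‖ := by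
        rw [norm_mul, Complex.norm_real, Real.norm_eq_abs, abs_of_pos hLpos]
      rw [this, hab]
      have t1 : ‖I * i4‖ ≤ C * π := by rw [norm_mul, Complex.norm_I, one_mul]; exact c2
      have t2 : ‖I * i3‖ ≤ C * π := by rw [norm_mul, Complex.norm_I, one_mul]; exact c1
      have t3 : ‖-(i1 - L * a)‖ ≤ ε * L := by rw [norm_neg]; exact b1
      calc _ ≤ ‖-(i1 - L * a)‖ + ‖i2 - L * b‖ + ‖I * i4‖ + ‖I * i3‖ := by
            refine (norm_add_le _ _).trans ?_
            gcongr
            refine (norm_sub_le _ _).trans ?_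
            gcongr
            exact norm_add_le _ _
        _ ≤ _ := by gcongr
    have hCL : C * π + C * π ≤ ε * L := by
      have : ε * L = 2 * π * C + ε := by rw [hL]; field_simp
      rw [this]; linarith
    have : L * ‖a - b‖ ≤ L * (3 * ε) := by linarith
    exact le_of_mul_le_mul_left this hLpos
  have : ‖a - b‖ ≤ 0 := by
    apply le_of_forall_pos_le_add
    intro ε hε
    have := key (ε / 3) (by positivity)
    linarith
  exact sub_eq_zero.1 (norm_le_zero_iff.1 this)

/-- Half of the Paley-Wiener theorem for integrable functions. -/
lemma integral_mul_exp_eq_zero {F : ℂ → ℂ} (hF : Differentiable ℂ F)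
    (hT : HasExpTypeLE F (2 * π)) (hI : Integrable (fun x : ℝ => F x)) {τ : ℝ} (hτ : 1 ≤ τ) :
    ∫ x : ℝ, F x * cexp (2 * π * τ * x * I) = 0 := by
  set G : ℂ → ℂ := fun z => F z * cexp (2 * π * τ * z * I) with hG
  have hGd : Differentiable ℂ G := by
    apply hF.mul
    fun_prop
  have hnexp : ∀ z : ℂ, ‖cexp (2 * π * τ * z * I)‖ = Real.exp (-(2 * π * τ * z.im)) := by
    intro z
    rw [Complex.norm_exp]
    congr 1
    have : (2 * π * τ * z * I : ℂ) = ((2 * π * τ : ℝ) : ℂ) * (z * I) := by push_cast; ring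
    rw [this, Complex.re_ofReal_mul]
    simp
  have hGnorm : ∀ x : ℝ, ‖G x‖ = ‖F x‖ := by
    intro x
    simp only [hG, norm_mul, hnexp]
    simp
  have hGI : Integrable (fun x : ℝ => G x) := by
    refine hI.norm.mono' (hGd.continuous.comp Complex.continuous_ofReal).aestronglyMeasurable ?_
    exact Eventually.of_forall fun x => (hGnorm x).le
  obtain ⟨P, hP0, hP⟩ := (hGd.isExactOn_univ).with_val_at 0 0
  have hP' : ∀ z, HasDerivAt P (G z) z := fun z => hP z (Set.mem_univ z)
  have hPd : Differentiable ℂ P := fun z => (hP' z).differentiableAt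
  have hPint : ∀ x y : ℝ, ∫ t : ℝ in x..y, G t = P y - P x := by
    intro x y
    apply intervalIntegral.integral_eq_sub_of_hasDerivAt (f := fun t : ℝ => P t)
    · intro t _
      exact (hP' t).comp_ofReal
    · exact hGI.intervalIntegrable
  set C : ℝ := ∫ x : ℝ, ‖G x‖ with hCdef
  have hPR : ∀ x : ℝ, ‖P x‖ ≤ C := by
    intro x
    have := hPint 0 x
    rw [Complex.ofReal_zero, hP0, sub_zero] at this
    rw [← this]
    refine intervalIntegral.norm_integral_le_integral_norm_uIoc.trans ?_
    exact setIntegral_le_integral hGI.norm (Eventually.of_forall fun x => norm_nonneg _)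
  -- growth
  obtain ⟨C1, hC1, hFb⟩ := hT 1 one_pos
  set B0 : ℝ := 2 * π + 1 + 2 * π * τ with hB0
  have hB0pos : 0 < B0 := by have := pi_pos; positivity
  have hGb : ∀ z : ℂ, ‖G z‖ ≤ C1 * Real.exp (B0 * ‖z‖) := by
    intro z
    simp only [hG, norm_mul, hnexp]
    calc _ ≤ C1 * Real.exp ((2 * π + 1) * ‖z‖) * Real.exp (2 * π * τ * ‖z‖) := by
          gcongr
          · exact hFb z
          · have h1 : -‖z‖ ≤ z.im := (abs_le.1 (Complex.abs_im_le_norm z)).1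
            have h2 : 0 ≤ 2 * π * τ := by have := pi_pos; positivity
            nlinarith
      _ = _ := by rw [mul_assoc, ← Real.exp_add]; congr 2; rw [hB0]; ring
  have hPb : ∀ z : ℂ, ‖P z‖ ≤ C1 * Real.exp ((B0 + 1) * ‖z‖) := by
    intro z
    have h := Convex.norm_image_sub_le_of_norm_deriv_le (𝕜 := ℂ) (f := P)
      (s := Metric.closedBall (0 : ℂ) ‖z‖) (C := C1 * Real.exp (B0 * ‖z‖)) (x := 0) (y := z)
      (fun x _ => hPd x) (fun x hx => by
        rw [(hP' x).deriv]
        refine (hGb x).trans ?_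
        gcongr
        simpa using hx) (convex_closedBall _ _) (by simp) (by simp)
    rw [hP0, sub_zero, sub_zero] at h
    refine h.trans ?_
    have : ‖z‖ ≤ Real.exp ‖z‖ := by linarith [Real.add_one_le_exp ‖z‖]
    calc _ ≤ C1 * Real.exp (B0 * ‖z‖) * Real.exp ‖z‖ := by gcongr
      _ = _ := by rw [mul_assoc, ← Real.exp_add]; congr 2; ring
  have hPi : ∀ ε > 0, ∃ C2 : ℝ, ∀ y : ℝ, 0 ≤ y → ‖P (y * I)‖ ≤ C2 * Real.exp (ε * y) := by
    intro ε hε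
    obtain ⟨C3, hC3, hF3⟩ := hT (ε / 2) (by positivity)
    refine ⟨C3 * (2 / ε), fun y hy => ?_⟩
    have h := Convex.norm_image_sub_le_of_norm_deriv_le (𝕜 := ℂ) (f := P)
      (s := segment ℝ (0 : ℂ) (y * I)) (C := C3 * Real.exp (ε / 2 * y)) (x := 0) (y := y * I)
      (fun x _ => hPd x) (fun x hx => by
        rw [(hP' x).deriv]
        rw [segment_eq_image] at hx
        obtain ⟨t, ht, rfl⟩ := hx
        have e0 : ((1 - t) • (0 : ℂ) + t • ((y : ℂ) * I)) = ((t * y : ℝ) : ℂ) * I := by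
          simp [mul_assoc]
        change ‖G ((1 - t) • (0 : ℂ) + t • ((y : ℂ) * I))‖ ≤ _
        rw [e0]
        have hty : 0 ≤ t * y := mul_nonneg ht.1 hy
        have hty' : t * y ≤ y := by nlinarith [ht.2]
        simp only [hG, norm_mul, hnexp]
        refine (mul_le_mul_of_nonneg_right (hF3 _) (Real.exp_pos _).le).trans ?_
        rw [mul_assoc, ← Real.exp_add]
        have e1 : ‖((t * y : ℝ) : ℂ) * I‖ = t * y := by
          rw [norm_mul, Complex.norm_I, mul_one, Complex.norm_real, Real.norm_eq_abs,
            abs_of_nonneg hty]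
        have e2 : (((t * y : ℝ) : ℂ) * I).im = t * y := by
          rw [Complex.im_ofReal_mul]; simp
        rw [e1, e2]
        gcongr
        have : 0 ≤ (t * y) * (τ - 1) := mul_nonneg hty (by linarith)
        nlinarith [pi_pos, mul_nonneg pi_pos.le this]) (convex_segment _ _)
        (left_mem_segment _ _ _) (right_mem_segment _ _ _)
    rw [hP0, sub_zero, sub_zero, norm_mul, Complex.norm_I, mul_one, Complex.norm_real,
      Real.norm_eq_abs, abs_of_nonneg hy] at h
    refine h.trans ?_
    have h3 : y ≤ 2 / ε * Real.exp (ε / 2 * y) := by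
      have := Real.add_one_le_exp (ε / 2 * y)
      have h4 : 2 / ε * (ε / 2 * y) = y := by field_simp
      have h5 : 2 / ε * (ε / 2 * y) ≤ 2 / ε * Real.exp (ε / 2 * y) := by gcongr; linarith
      linarith
    calc _ ≤ C3 * Real.exp (ε / 2 * y) * (2 / ε * Real.exp (ε / 2 * y)) := by gcongr
      _ = C3 * (2 / ε) * (Real.exp (ε / 2 * y) * Real.exp (ε / 2 * y)) := by ring
      _ = _ := by rw [← Real.exp_add]; congr 2; ring
  have hPL : ∀ ε : ℝ, 0 < ε → ∀ w : ℂ, 0 ≤ w.re → ‖P (w * I) * cexp (-ε * w)‖ ≤ C := by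
    intro ε hε w hw
    have hne : ∀ z : ℂ, ‖cexp (-ε * z)‖ = Real.exp (-ε * z.re) := by
      intro z
      rw [Complex.norm_exp]; simp
    apply PhragmenLindelof.right_half_plane_of_bounded_on_real
      (f := fun w : ℂ => P (w * I) * cexp (-ε * w)) _ _ _ _ hw
    · apply Differentiable.diffContOnCl
      apply Differentiable.mul
      · exact hPd.comp (by fun_prop)
      · fun_prop
    · refine ⟨1, by norm_num, B0 + 1 + ε, ?_⟩
      apply Asymptotics.IsBigO.of_bound C1
      apply Eventually.of_forall
      intro z
      rw [norm_mul, hne, Real.rpow_one, Real.norm_eq_abs, abs_of_pos (Real.exp_pos _)]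
      have h1 := hPb (z * I)
      rw [norm_mul, Complex.norm_I, mul_one] at h1
      calc _ ≤ C1 * Real.exp ((B0 + 1) * ‖z‖) * Real.exp (ε * ‖z‖) := by
            have h2 : -‖z‖ ≤ z.re := (abs_le.1 (Complex.abs_re_le_norm z)).1
            have h3 : -ε * z.re ≤ ε * ‖z‖ := by nlinarith
            exact mul_le_mul h1 (Real.exp_le_exp.2 h3) (Real.exp_pos _).le (by positivity)
        _ = _ := by rw [mul_assoc, ← Real.exp_add]; congr 2; ring
    · obtain ⟨C2, hC2⟩ := hPi ε hε
      refine isBoundedUnder_of_eventually_le (a := C2) ?_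
      filter_upwards [eventually_ge_atTop 0] with y hy
      rw [norm_mul, hne, Complex.ofReal_re]
      calc _ ≤ C2 * Real.exp (ε * y) * Real.exp (-ε * y) :=
            mul_le_mul_of_nonneg_right (hC2 y hy) (Real.exp_pos _).le
        _ = C2 := by rw [mul_assoc, ← Real.exp_add]; simp
    · intro x
      rw [norm_mul, hne]
      have : ((x : ℂ) * I * I) = ((-x : ℝ) : ℂ) := by
        rw [mul_assoc, Complex.I_mul_I]; simp
      rw [this]
      simpa using hPR (-x)
  have hPU : ∀ z : ℂ, 0 ≤ z.im → ‖P z‖ ≤ C := by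
    intro z hz
    have h1 : ∀ ε > 0, ‖P z‖ * Real.exp (-ε * z.im) ≤ C := by
      intro ε hε
      have := hPL ε hε (-I * z) (by simpa using hz)
      have e : -I * z * I = z := by
        calc -I * z * I = -(I * I) * z := by ring
          _ = z := by rw [Complex.I_mul_I]; ring
      rw [e, norm_mul, Complex.norm_exp] at this
      simpa using this
    have h2 : Tendsto (fun ε : ℝ => ‖P z‖ * Real.exp (-ε * z.im)) (nhdsWithin 0 (Set.Ioi 0))
        (nhds (‖P z‖ * Real.exp (-0 * z.im))) := by
      apply Tendsto.mono_left _ nhdsWithin_le_nhds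
      apply Continuous.tendsto (f := fun ε : ℝ => ‖P z‖ * Real.exp (-ε * z.im))
      fun_prop
    have h3 := le_of_tendsto h2 (by
      filter_upwards [self_mem_nhdsWithin] with ε hε using h1 ε hε)
    simpa using h3
  have hlim := limits_eq_of_bounded hPd hPU (a := ∫ x : ℝ in Set.Ioi 0, G x)
    (b := -∫ x : ℝ in Set.Iic 0, G x) (by
      have := intervalIntegral_tendsto_integral_Ioi (f := fun x : ℝ => G x) 0
        hGI.integrableOn tendsto_id
      refine this.congr fun x => ?_
      rw [hPint]; simp [hP0]) (by
      have := (intervalIntegral_tendsto_integral_Iic (f := fun x : ℝ => G x) 0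
        hGI.integrableOn tendsto_id).neg
      refine this.congr fun x => ?_
      rw [hPint]; simp [hP0])
  have hsplit := intervalIntegral.integral_Iic_add_Ioi (f := fun x : ℝ => G x) (b := 0) hGI.integrableOn
    hGI.integrableOn
  change ∫ x : ℝ, G x = 0
  rw [← hsplit, hlim]
  simp

/-- Integrable functions whose Fourier transform vanishes on `(-∞, -1]`. -/
def Vanish (f : ℝ → ℂ) : Prop :=
  Integrable f ∧ ∀ τ : ℝ, 1 ≤ τ → ∫ x : ℝ, f x * cexp (2 * π * τ * x * I) = 0

lemma norm_cexp_aux (τ x : ℝ) : ‖cexp (2 * π * τ * x * I)‖ = 1 := by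
  have : (2 * π * τ * x * I : ℂ) = ((2 * π * τ * x : ℝ) : ℂ) * I := by push_cast; ring
  rw [this, Complex.norm_exp_ofReal_mul_I]

lemma Vanish.integrable_mul {f : ℝ → ℂ} (hf : Vanish f) (τ : ℝ) :
    Integrable (fun x : ℝ => f x * cexp (2 * π * τ * x * I)) := by
  refine hf.1.mul_bdd (c := 1) ?_ ?_
  · apply Continuous.aestronglyMeasurable; fun_prop
  · exact Eventually.of_forall fun x => (norm_cexp_aux τ x).le

lemma Vanish.mul_exp {f : ℝ → ℂ} (hf : Vanish f) :
    Vanish (fun x : ℝ => f x * cexp (2 * π * x * I)) := by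
  constructor
  · simpa using hf.integrable_mul 1
  · intro τ hτ
    rw [← hf.2 (1 + τ) (by linarith)]
    congr 1
    ext x
    rw [mul_assoc, ← Complex.exp_add]
    congr 2
    push_cast
    ring

lemma Vanish.add_smul {f g : ℝ → ℂ} (hf : Vanish f) (hg : Vanish g) (c : ℂ) :
    Vanish (fun x : ℝ => f x + c * g x) := by
  constructor
  · exact hf.1.add (hg.1.const_mul c)
  · intro τ hτ
    have : ∀ x : ℝ, (f x + c * g x) * cexp (2 * π * τ * x * I) =
        f x * cexp (2 * π * τ * x * I) + c * (g x * cexp (2 * π * τ * x * I)) := by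
      intro x; ring
    simp_rw [this]
    rw [integral_add (hf.integrable_mul τ) ((hg.integrable_mul τ).const_mul c),
      integral_const_mul, hf.2 τ hτ, hg.2 τ hτ]
    simp

lemma ofReal_add_mul_I_ne {a : ℝ} (ha : a ≠ 0) (x : ℝ) : (x + a * I : ℂ) ≠ 0 := by
  intro h
  have := congrArg Complex.im h
  simp at this
  exact ha this

lemma inv_eq_integral {a : ℝ} (ha : 0 < a) (x : ℝ) :
    (x + a * I : ℂ)⁻¹ = -I * ∫ s : ℝ in Set.Ioi 0, cexp ((-a + x * I) * s) := by
  rw [integral_exp_mul_complex_Ioi (by simpa using ha)]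
  have h1 := ofReal_add_mul_I_ne ha.ne' x
  have h2 : (-a + x * I : ℂ) = I * (x + a * I) := by
    linear_combination (-(a : ℂ)) * Complex.I_mul_I
  rw [h2]
  have hI := Complex.I_ne_zero
  simp
  field_simp

lemma Vanish.mul_inv {f : ℝ → ℂ} (hf : Vanish f) {a : ℝ} (ha : 0 < a) :
    Vanish (fun x : ℝ => f x * (x + a * I : ℂ)⁻¹) := by
  constructor
  · refine hf.1.mul_bdd (c := a⁻¹) ?_ ?_
    · apply Continuous.aestronglyMeasurable
      apply Continuous.inv₀ (by fun_prop)
      exact ofReal_add_mul_I_ne ha.ne'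
    · refine Eventually.of_forall fun x => ?_
      rw [norm_inv]
      gcongr
      have := Complex.abs_im_le_norm (x + a * I : ℂ)
      simpa [abs_of_pos ha] using this
  · intro τ hτ
    have e : ∀ x : ℝ, f x * (x + a * I : ℂ)⁻¹ * cexp (2 * π * τ * x * I) =
        -I * ∫ s : ℝ in Set.Ioi 0,
          (f x * cexp (2 * π * τ * x * I)) * cexp ((-a + x * I) * s) := by
      intro x
      rw [inv_eq_integral ha, integral_const_mul]
      ring
    simp_rw [e]
    rw [integral_const_mul, integral_integral_swap]
    · have : ∀ s ∈ Set.Ioi (0 : ℝ), ∫ x : ℝ, (f x * cexp (2 * π * τ * x * I)) *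
          cexp ((-a + x * I) * s) = 0 := by
        intro s hs
        have hs0 : (0 : ℝ) < s := hs
        have h1 := hf.2 (τ + s / (2 * π)) (by have : 0 < s / (2 * π) := by positivity
                                              linarith)
        have e2 : ∀ x : ℝ, (f x * cexp (2 * π * τ * x * I)) * cexp ((-a + x * I) * s) =
            cexp (-a * s) * (f x * cexp (2 * π * ((τ + s / (2 * π) : ℝ) : ℂ) * x * I)) := by
          intro x
          rw [mul_assoc, ← Complex.exp_add, mul_left_comm, ← Complex.exp_add]
          congr 2
          have : (π : ℂ) ≠ 0 := by exact_mod_cast pi_ne_zero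
          push_cast
          field_simp
          ring
        simp_rw [e2]
        rw [integral_const_mul, h1, mul_zero]
      rw [setIntegral_congr_fun measurableSet_Ioi this]
      simp
    · have h1 : Integrable (fun s : ℝ => cexp (-a * s)) (volume.restrict (Set.Ioi 0)) := by
        exact integrableOn_exp_mul_complex_Ioi (by simpa using ha) 0
      have h2 := (hf.integrable_mul τ).mul_prod h1
      have h3 := h2.mul_bdd (g := fun z : ℝ × ℝ => cexp (z.1 * z.2 * I)) (c := 1)
        (by apply Continuous.aestronglyMeasurable; fun_prop)
        (Eventually.of_forall fun z => by
          have := Complex.norm_exp_ofReal_mul_I (z.1 * z.2)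
          push_cast at this
          exact this.le)
      refine h3.congr (Eventually.of_forall fun z => ?_)
      simp only [Function.uncurry]
      rw [mul_assoc, ← Complex.exp_add]
      congr 2
      ring

/-- The Blaschke factor `(x - ia)/(x + ia)`. -/
noncomputable def bl (a : ℝ) (x : ℝ) : ℂ := 1 - 2 * a * I * (x + a * I : ℂ)⁻¹

lemma Vanish.mul_bl {f : ℝ → ℂ} (hf : Vanish f) {a : ℝ} (ha : 0 ≤ a) :
    Vanish (fun x : ℝ => f x * bl a x) := by
  rcases ha.eq_or_lt with rfl | ha
  · simpa [bl] using hf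
  · have := hf.add_smul (hf.mul_inv ha) (-(2 * a * I))
    convert this using 2 with x
    simp only [bl]
    ring

lemma Vanish.mul_kap {f : ℝ → ℂ} (hf : Vanish f) :
    Vanish (fun x : ℝ => f x * (1 - I * (x + I : ℂ)⁻¹)) := by
  have := hf.add_smul (hf.mul_inv one_pos) (-I)
  convert this using 2 with x
  push_cast
  ring

lemma bl_eq {a : ℝ} (ha : 0 < a) (x : ℝ) : bl a x = (x - a * I) / (x + a * I) := by
  have h1 := ofReal_add_mul_I_ne ha.ne' x
  rw [bl]
  field_simp
  ring

lemma norm_bl {a : ℝ} (ha : 0 ≤ a) (x : ℝ) : ‖bl a x‖ = 1 := by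
  rcases ha.eq_or_lt with rfl | ha
  · simp [bl]
  · rw [bl_eq ha, norm_div]
    have : (x - a * I : ℂ) = (starRingEnd ℂ) (x + a * I) := by simp [sub_eq_add_neg]
    rw [this, RCLike.norm_conj, div_self]
    exact norm_ne_zero_iff.2 (ofReal_add_mul_I_ne ha.ne' x)

lemma bl_neg {a : ℝ} (x : ℝ) : bl a (-x) = (starRingEnd ℂ) (bl a x) := by
  simp only [bl, map_sub, map_mul, map_inv₀, map_add, Complex.conj_ofReal, Complex.conj_I, map_one,
    map_ofNat]
  push_cast
  have : (-(x : ℂ) + a * I) = -(x + a * -I) := by ring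
  rw [this, inv_neg]
  ring

lemma norm_sq_add_mul_I (a x : ℝ) : ‖(x + a * I : ℂ)‖ ^ 2 = x ^ 2 + a ^ 2 := by
  rw [← Complex.normSq_eq_norm_sq, Complex.normSq_add_mul_I]

lemma hasDerivAt_bl {a : ℝ} (ha : 0 ≤ a) {x : ℝ} : 
    HasDerivAt (bl a) (2 * a * I / (x + a * I : ℂ) ^ 2) x := by
  rcases ha.eq_or_lt with rfl | ha
  · have : bl 0 = fun _ => 1 := by ext x; simp [bl]
    rw [this]
    simpa using hasDerivAt_const x (1 : ℂ)
  · have h1 := ofReal_add_mul_I_ne ha.ne' x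
    have h2 : HasDerivAt (fun y : ℝ => (y + a * I : ℂ)) 1 x :=
      (Complex.ofRealCLM.hasDerivAt (x := x)).add_const (a * I : ℂ)
    have h3 := ((h2.inv h1).const_mul (2 * a * I : ℂ)).const_sub 1
    refine (h3.congr_deriv ?_)
    ring

lemma norm_deriv_bl {a : ℝ} (ha : 0 ≤ a) (x : ℝ) :
    ‖(2 * a * I / (x + a * I : ℂ) ^ 2)‖ = 2 * a / (x ^ 2 + a ^ 2) := by
  rw [norm_div, norm_pow, norm_sq_add_mul_I]
  simp [abs_of_nonneg ha]

lemma continuous_bl {a : ℝ} (ha : 0 ≤ a) : Continuous (bl a) :=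
  continuous_iff_continuousAt.2 fun _ => (hasDerivAt_bl ha).continuousAt

/-- Lower bound for the Poisson kernel. -/
lemma poisson_lower {Θ : ℂ} (hΘ : ‖Θ‖ = 1) {t X : ℝ} (ht : 0 < t) (ht1 : t < 1)
    (hX : ‖Θ - 1‖ ≤ X) :
    t * (2 - t) / (t ^ 2 + X ^ 2) ≤ 1 + 2 * (((1 - t : ℝ) * Θ) / (1 - (1 - t : ℝ) * Θ)).re := by
  obtain ⟨a, b⟩ := Θ
  have h1 : a ^ 2 + b ^ 2 = 1 := by
    have := Complex.sq_norm (⟨a, b⟩ : ℂ)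
    rw [hΘ, Complex.normSq_mk] at this
    linarith
  have h2 : (a - 1) ^ 2 + b ^ 2 ≤ X ^ 2 := by
    have := Complex.sq_norm ((⟨a, b⟩ : ℂ) - 1)
    rw [Complex.normSq_apply] at this
    simp at this
    nlinarith [norm_nonneg ((⟨a, b⟩ : ℂ) - 1)]
  have hN : 0 < (1 - (1 - t) * a) ^ 2 + ((1 - t) * b) ^ 2 := by
    have ha : a ≤ 1 := by nlinarith
    have : 0 < 1 - (1 - t) * a := by nlinarith
    positivity
  have e : 1 + 2 * (((1 - t : ℝ) * (⟨a, b⟩ : ℂ)) / (1 - (1 - t : ℝ) * (⟨a, b⟩ : ℂ))).re =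
      t * (2 - t) / ((1 - (1 - t) * a) ^ 2 + ((1 - t) * b) ^ 2) := by
    rw [Complex.div_re, Complex.normSq_apply]
    simp only [Complex.sub_re, Complex.sub_im, Complex.re_ofReal_mul, Complex.im_ofReal_mul,
      Complex.one_re, Complex.one_im]
    have : (1 - (1 - t) * a) * (1 - (1 - t) * a) + (0 - (1 - t) * b) * (0 - (1 - t) * b) =
      (1 - (1 - t) * a) ^ 2 + ((1 - t) * b) ^ 2 := by ring
    rw [this]
    generalize hM : (1 - (1 - t) * a) ^ 2 + ((1 - t) * b) ^ 2 = M at hN ⊢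
    field_simp
    linear_combination (-(1 - t) ^ 2) * h1 - hM
  rw [e]
  apply div_le_div_of_nonneg_left
  · nlinarith
  · exact hN
  · nlinarith [sq_nonneg (a - 1), sq_nonneg b, mul_nonneg ht.le (add_nonneg (sq_nonneg (a - 1)) (sq_nonneg b))]

lemma poisson_nonneg {Θ : ℂ} (hΘ : ‖Θ‖ = 1) {t : ℝ} (ht : 0 < t) (ht1 : t < 1) :
    0 ≤ 1 + 2 * (((1 - t : ℝ) * Θ) / (1 - (1 - t : ℝ) * Θ)).re := by
  refine le_trans ?_ (poisson_lower hΘ ht ht1 le_rfl)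
  have : 0 < 2 - t := by linarith
  positivity

/-- Poisson averages of `Θ` do not change the integral. -/
lemma poisson_integral {f : ℝ → ℝ} (hf : Integrable f) {Θ : ℝ → ℂ} (hΘc : Continuous Θ)
    (hΘ : ∀ x, ‖Θ x‖ = 1) (hv : ∀ n : ℕ, ∫ x : ℝ, (f x : ℂ) * Θ x ^ (n + 1) = 0)
    {t : ℝ} (ht : 0 < t) (ht1 : t < 1) :
    Integrable (fun x => f x * (1 + 2 * (((1 - t : ℝ) * Θ x) / (1 - (1 - t : ℝ) * Θ x)).re)) ∧
    ∫ x : ℝ, f x * (1 + 2 * (((1 - t : ℝ) * Θ x) / (1 - (1 - t : ℝ) * Θ x)).re) = ∫ x, f x := by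
  have hr0 : 0 < 1 - t := by linarith
  have hw : ∀ x, ‖((1 - t : ℝ) * Θ x : ℂ)‖ = 1 - t := by
    intro x
    rw [norm_mul, hΘ, mul_one, Complex.norm_real, Real.norm_eq_abs, abs_of_pos hr0]
  have hne : ∀ x, (1 - (1 - t : ℝ) * Θ x : ℂ) ≠ 0 := by
    intro x h
    have : ((1 - t : ℝ) * Θ x : ℂ) = 1 := by linear_combination -h
    have h2 := hw x
    rw [this, norm_one] at h2
    linarith
  have hfc : Integrable (fun x => (f x : ℂ)) := hf.ofReal
  have hIc : Integrable (fun x => (f x : ℂ) * (((1 - t : ℝ) * Θ x) / (1 - (1 - t : ℝ) * Θ x))) := by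
    refine hfc.mul_bdd (c := t⁻¹) ?_ ?_
    · apply Continuous.aestronglyMeasurable
      exact Continuous.div (by fun_prop) (by fun_prop) hne
    · refine Eventually.of_forall fun x => ?_
      rw [norm_div, hw, div_eq_mul_inv]
      have h1 : t ≤ ‖(1 - (1 - t : ℝ) * Θ x : ℂ)‖ := by
        have := norm_sub_norm_le (1 : ℂ) ((1 - t : ℝ) * Θ x)
        rw [hw, norm_one] at this
        linarith
      have h2 : ‖(1 - (1 - t : ℝ) * Θ x : ℂ)‖⁻¹ ≤ t⁻¹ := by gcongr
      have h3 : 0 < t⁻¹ := by positivity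
      calc _ ≤ (1 - t) * t⁻¹ := by gcongr
        _ ≤ 1 * t⁻¹ := by gcongr; linarith
        _ = _ := one_mul _
  have hzero : ∫ x, (f x : ℂ) * (((1 - t : ℝ) * Θ x) / (1 - (1 - t : ℝ) * Θ x)) = 0 := by
    have hs := hasSum_integral_of_summable_integral_norm
      (F := fun (n : ℕ) (x : ℝ) => (f x : ℂ) * ((1 - t : ℝ) * Θ x) ^ (n + 1)) (μ := volume)
      (by
        intro n
        refine hfc.mul_bdd (c := (1 - t) ^ (n + 1)) ?_ ?_
        · apply Continuous.aestronglyMeasurable; fun_prop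
        · exact Eventually.of_forall fun x => by rw [norm_pow, hw])
      (by
        have : ∀ n : ℕ, ∫ x : ℝ, ‖(f x : ℂ) * ((1 - t : ℝ) * Θ x) ^ (n + 1)‖ =
            (1 - t) ^ n * ((1 - t) * ∫ x, ‖(f x : ℂ)‖) := by
          intro n
          simp_rw [norm_mul _ (_ ^ (n + 1)), norm_pow, hw]
          rw [integral_mul_const]
          ring
        simp_rw [this]
        exact (summable_geometric_of_lt_one hr0.le (by linarith)).mul_right _)
    have h0 : ∀ n : ℕ, ∫ x : ℝ, (f x : ℂ) * ((1 - t : ℝ) * Θ x) ^ (n + 1) = 0 := by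
      intro n
      have : ∀ x, (f x : ℂ) * ((1 - t : ℝ) * Θ x) ^ (n + 1) =
          ((1 - t : ℝ) : ℂ) ^ (n + 1) * ((f x : ℂ) * Θ x ^ (n + 1)) := by
        intro x; ring
      simp_rw [this]
      rw [integral_const_mul, hv, mul_zero]
    simp_rw [h0] at hs
    have h1 := hs.unique hasSum_zero
    rw [← h1]
    congr 1
    ext x
    have hg := (hasSum_geometric_of_norm_lt_one (ξ := ((1 - t : ℝ) * Θ x : ℂ))
      (by rw [hw]; linarith)).mul_left ((f x : ℂ) * ((1 - t : ℝ) * Θ x))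
    have hg2 : (fun n : ℕ => (f x : ℂ) * ((1 - t : ℝ) * Θ x) ^ (n + 1)) =
        fun n : ℕ => (f x : ℂ) * ((1 - t : ℝ) * Θ x) * ((1 - t : ℝ) * Θ x) ^ n := by
      ext n; ring
    rw [hg2, hg.tsum_eq]
    ring
  have hre : ∀ x, f x * (1 + 2 * (((1 - t : ℝ) * Θ x) / (1 - (1 - t : ℝ) * Θ x)).re) =
      f x + 2 * ((f x : ℂ) * (((1 - t : ℝ) * Θ x) / (1 - (1 - t : ℝ) * Θ x))).re := by
    intro x
    rw [Complex.re_ofReal_mul]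
    ring
  simp_rw [hre]
  have hI2 : Integrable (fun x => 2 *
      ((f x : ℂ) * (((1 - t : ℝ) * Θ x) / (1 - (1 - t : ℝ) * Θ x))).re) := hIc.re.const_mul 2
  refine ⟨hf.add hI2, ?_⟩
  rw [integral_add hf hI2, integral_const_mul]
  have : ∫ x, ((f x : ℂ) * (((1 - t : ℝ) * Θ x) / (1 - (1 - t : ℝ) * Θ x))).re = 0 := by
    have := integral_re hIc
    simp only [RCLike.re_eq_complex_re] at this
    rw [this, hzero, Complex.zero_re]
  rw [this]
  ring

lemma kernel_integral {t D : ℝ} (ht : 0 < t) (hD : 0 < D) (p δ : ℝ) :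
    ∫ x in (p - δ)..(p + δ), t * (2 - t) / (t ^ 2 + (D * |x - p|) ^ 2) =
      (2 - t) * (2 / D) * Real.arctan (D * δ / t) := by
  have h := intervalIntegral.integral_eq_sub_of_hasDerivAt (a := p - δ) (b := p + δ)
    (f := fun x => (2 - t) / D * Real.arctan (D * (x - p) / t))
    (f' := fun x => t * (2 - t) / (t ^ 2 + (D * |x - p|) ^ 2)) (by
      intro x _
      have h1 : HasDerivAt (fun x : ℝ => D * (x - p) / t) (D / t) x := by
        have := (((hasDerivAt_id x).sub_const p).const_mul D).div_const t
        simpa using this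
      have h2 := (h1.arctan).const_mul ((2 - t) / D)
      refine h2.congr_deriv ?_
      rw [mul_pow, sq_abs]
      have : 0 < t ^ 2 + D ^ 2 * (x - p) ^ 2 := by positivity
      have : 0 < 1 + (D * (x - p) / t) ^ 2 := by positivity
      field_simp) (by
      apply Continuous.intervalIntegrable
      apply Continuous.div (by fun_prop) (by fun_prop)
      intro x
      positivity)
  rw [h]
  have e1 : D * (p + δ - p) / t = D * δ / t := by ring
  have e2 : D * (p - δ - p) / t = -(D * δ / t) := by ring
  simp only [e1, e2, Real.arctan_neg]
  ring

lemma local_bound {f : ℝ → ℝ} {Θ : ℝ → ℂ} (hΘ : ∀ x, ‖Θ x‖ = 1) {t c D δ p : ℝ}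
    (ht : 0 < t) (ht1 : t < 1) (hc : 0 ≤ c) (hD : 0 < D) (hδ : 0 < δ)
    (hI : Integrable (fun x => f x * (1 + 2 * (((1 - t : ℝ) * Θ x) / (1 - (1 - t : ℝ) * Θ x)).re)))
    (h : ∀ x ∈ Set.Icc (p - δ) (p + δ), c ≤ f x ∧ ‖Θ x - 1‖ ≤ D * |x - p|) :
    c * ((2 - t) * (2 / D) * Real.arctan (D * δ / t)) ≤
      ∫ x in Set.Icc (p - δ) (p + δ),
        f x * (1 + 2 * (((1 - t : ℝ) * Θ x) / (1 - (1 - t : ℝ) * Θ x)).re) := by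
  rw [← kernel_integral ht hD p δ, ← intervalIntegral.integral_const_mul,
    intervalIntegral.integral_of_le (by linarith), ← integral_Icc_eq_integral_Ioc]
  apply setIntegral_mono_on
  · apply Continuous.integrableOn_Icc
    apply Continuous.mul (by fun_prop)
    apply Continuous.div (by fun_prop) (by fun_prop)
    intro x
    positivity
  · exact hI.integrableOn
  · exact measurableSet_Icc
  · intro x hx
    obtain ⟨h1, h2⟩ := h x hx
    have h3 := poisson_lower (hΘ x) ht ht1 h2
    have h4 : 0 ≤ t * (2 - t) / (t ^ 2 + (D * |x - p|) ^ 2) := by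
      have : 0 < 2 - t := by linarith
      positivity
    exact mul_le_mul h1 h3 h4 (hc.trans h1)

lemma eventually_local {f : ℝ → ℝ} (hfc : Continuous f) (hf0 : ∀ x, 0 ≤ f x) {Θ : ℝ → ℂ}
    {p : ℝ} {d : ℂ} (hd : HasDerivAt Θ d p) (hp : Θ p = 1) {D ε : ℝ} (hdD : ‖d‖ ≤ D)
    (hε : 0 < ε) :
    ∃ δ0 > 0, ∀ δ < δ0, ∀ x ∈ Set.Icc (p - δ) (p + δ),
      max (f p - ε) 0 ≤ f x ∧ ‖Θ x - 1‖ ≤ (D + ε) * |x - p| := by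
  have h1 : ∀ᶠ x in nhds p, f p - ε < f x := by
    have := hfc.tendsto p
    exact this.eventually (lt_mem_nhds (by linarith))
  have h2 : ∀ᶠ x in nhds p, ‖Θ x - Θ p - (x - p) • d‖ ≤ ε * ‖x - p‖ :=
    (hasDerivAt_iff_isLittleO.1 hd).def hε
  obtain ⟨δ0, hδ0, hb⟩ := Metric.eventually_nhds_iff.1 (h1.and h2)
  refine ⟨δ0, hδ0, fun δ hδ x hx => ?_⟩
  have hx' : dist x p < δ0 := by
    rw [Real.dist_eq, abs_lt]
    constructor <;> linarith [hx.1, hx.2]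
  obtain ⟨h3, h4⟩ := hb hx'
  refine ⟨max_le h3.le (hf0 x), ?_⟩
  rw [hp] at h4
  have h5 : ‖(x - p) • d‖ ≤ D * |x - p| := by
    rw [norm_smul, Real.norm_eq_abs, mul_comm]
    gcongr
  calc ‖Θ x - 1‖ = ‖(Θ x - 1 - (x - p) • d) + (x - p) • d‖ := by congr 1; ring
    _ ≤ ‖Θ x - 1 - (x - p) • d‖ + ‖(x - p) • d‖ := norm_add_le _ _
    _ ≤ ε * |x - p| + D * |x - p| := by
        rw [Real.norm_eq_abs] at h4; gcongr
    _ = _ := by ring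

/-- Two-point lower bound for the integral. -/
lemma two_point {f : ℝ → ℝ} (hf : Integrable f) (hfc : Continuous f) (hf0 : ∀ x, 0 ≤ f x)
    {Θ : ℝ → ℂ} (hΘc : Continuous Θ)
    (hΘ : ∀ x, ‖Θ x‖ = 1) (hv : ∀ n : ℕ, ∫ x : ℝ, (f x : ℂ) * Θ x ^ (n + 1) = 0)
    {p q : ℝ} (hpq : p < q) {d e : ℂ} (hd : HasDerivAt Θ d p) (he : HasDerivAt Θ e q)
    (hp : Θ p = 1) (hq : Θ q = 1) {D : ℝ} (hD : 0 < D) (hdD : ‖d‖ ≤ D) (heD : ‖e‖ ≤ D) :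
    (f p + f q) * (2 * π / D) ≤ ∫ x, f x := by
  have key : ∀ ε > 0, (max (f p - ε) 0 + max (f q - ε) 0) * (2 * π / (D + ε)) ≤ ∫ x, f x := by
    intro ε hε
    obtain ⟨δ1, hδ1, h1⟩ := eventually_local hfc hf0 hd hp hdD hε
    obtain ⟨δ2, hδ2, h2⟩ := eventually_local hfc hf0 he hq heD hε
    obtain ⟨δ, hδ0, hδ⟩ := exists_between (lt_min (lt_min hδ1 hδ2) (half_pos (sub_pos.2 hpq)))
    have hl1 : δ < δ1 := hδ.trans_le ((min_le_left _ _).trans (min_le_left _ _))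
    have hl2 : δ < δ2 := hδ.trans_le ((min_le_left _ _).trans (min_le_right _ _))
    have hl3 : δ < (q - p) / 2 := hδ.trans_le (min_le_right _ _)
    have hDε : 0 < D + ε := by linarith
    have hfin : ∀ t : ℝ, 0 < t → t < 1 → (max (f p - ε) 0 + max (f q - ε) 0) *
        ((2 - t) * (2 / (D + ε)) * Real.arctan ((D + ε) * δ / t)) ≤ ∫ x, f x := by
      intro t ht ht1
      obtain ⟨hI, hE⟩ := poisson_integral hf hΘc hΘ hv ht ht1
      have b1 := local_bound hΘ ht ht1 (le_max_right (f p - ε) 0) hDε hδ0 hI (h1 δ hl1)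
      have b2 := local_bound hΘ ht ht1 (le_max_right (f q - ε) 0) hDε hδ0 hI (h2 δ hl2)
      rw [← hE, add_mul]
      refine (add_le_add b1 b2).trans ?_
      rw [← setIntegral_union _ measurableSet_Icc hI.integrableOn hI.integrableOn]
      · exact setIntegral_le_integral hI (Eventually.of_forall fun x =>
          mul_nonneg (hf0 x) (poisson_nonneg (hΘ x) ht ht1))
      · rw [Set.disjoint_left]
        intro x hx hx'
        linarith [hx.2, hx'.1]
    have hlim : Tendsto (fun t : ℝ => (max (f p - ε) 0 + max (f q - ε) 0) *
        ((2 - t) * (2 / (D + ε)) * Real.arctan ((D + ε) * δ / t))) (nhdsWithin 0 (Set.Ioi 0))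
        (nhds ((max (f p - ε) 0 + max (f q - ε) 0) * ((2 - 0) * (2 / (D + ε)) * (π / 2)))) := by
      apply Tendsto.const_mul
      apply Tendsto.mul
      · apply Tendsto.mul_const
        apply Tendsto.mono_left _ nhdsWithin_le_nhds
        exact Continuous.tendsto (f := fun t : ℝ => 2 - t) (by fun_prop) 0
      · have h3 : Tendsto (fun t : ℝ => (D + ε) * δ / t) (nhdsWithin 0 (Set.Ioi 0)) atTop := by
          simp_rw [div_eq_mul_inv]
          exact tendsto_inv_nhdsGT_zero.const_mul_atTop (by positivity)
        exact (Real.tendsto_arctan_atTop.mono_right nhdsWithin_le_nhds).comp h3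
    have := le_of_tendsto hlim (by
      filter_upwards [Ioo_mem_nhdsGT (show (0 : ℝ) < 1 by norm_num)] with t ht
      exact hfin t ht.1 ht.2)
    refine le_trans (le_of_eq ?_) this
    ring
  have hlim : Tendsto (fun ε : ℝ => (max (f p - ε) 0 + max (f q - ε) 0) * (2 * π / (D + ε)))
      (nhdsWithin 0 (Set.Ioi 0))
      (nhds ((max (f p - 0) 0 + max (f q - 0) 0) * (2 * π / (D + 0)))) := by
    apply Tendsto.mono_left _ nhdsWithin_le_nhds
    apply ContinuousAt.tendsto (f := fun ε : ℝ =>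
      (max (f p - ε) 0 + max (f q - ε) 0) * (2 * π / (D + ε)))
    apply ContinuousAt.mul
    · fun_prop
    · apply ContinuousAt.div (by fun_prop) (by fun_prop)
      simpa using hD.ne'
  have := le_of_tendsto hlim (by
    filter_upwards [self_mem_nhdsWithin] with ε hε using key ε hε)
  simpa [hf0] using this

lemma kernel_ge (x : ℝ) : x ^ 2 / (x ^ 2 + 1) ≤ pairCorKernel x := by
  rcases eq_or_ne x 0 with rfl | hx
  · simp [pairCorKernel]
  have hx2 : 0 < x ^ 2 := by positivity
  have hpi := Real.pi_gt_three
  have hmain : Real.sin (π * x) ^ 2 * (x ^ 2 + 1) ≤ (π * x) ^ 2 := by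
    rcases le_total 1 |x| with h | h
    · have h1 : 1 ≤ x ^ 2 := by rw [← sq_abs]; nlinarith
      have h2 := Real.sin_sq_le_one (π * x)
      have h3 : (9 : ℝ) ≤ π ^ 2 := by nlinarith
      have : Real.sin (π * x) ^ 2 * (x ^ 2 + 1) ≤ 1 * (x ^ 2 + 1) := by gcongr
      rw [mul_pow]
      nlinarith
    · set y : ℝ := π * x / 2 with hy
      have hxy : π * x = 2 * y := by rw [hy]; ring
      have hb : |y| ≤ 3 * π / 2 := by
        rw [hy, abs_div, abs_mul, abs_of_pos pi_pos, abs_two]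
        nlinarith
      obtain ⟨hb1, hb2⟩ := abs_le.1 hb
      have hxle : |x| ≤ 1 := h
      have hs : Real.sin y ^ 2 ≤ y ^ 2 := Real.sin_sq_le_sq
      have hc0 : 0 ≤ Real.cos y ^ 2 * (y ^ 2 + 1) ∧ Real.cos y ^ 2 * (y ^ 2 + 1) ≤ 1 := by
        refine ⟨by positivity, ?_⟩
        rcases eq_or_ne (Real.cos y) 0 with h0 | h0
        · rw [h0]; norm_num
        -- tangent inequality
        · rcases eq_or_ne y 0 with hy0 | hy0
          · rw [hy0]; simp
          have habs : |y| < π / 2 ∨ |y| = π / 2 := by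
            apply lt_or_eq_of_le
            rw [hy, abs_div, abs_mul, abs_of_pos pi_pos, abs_two]
            nlinarith
          rcases habs with hlt | heq
          · have hlt2 : |y| < Real.tan |y| := Real.lt_tan (abs_pos.2 hy0) hlt
            have hcp : 0 < Real.cos |y| := Real.cos_pos_of_mem_Ioo ⟨by linarith [abs_nonneg y, pi_pos], hlt⟩
            rw [Real.tan_eq_sin_div_cos, lt_div_iff₀ hcp] at hlt2
            have e1 : Real.cos |y| = Real.cos y := Real.cos_abs y
            have e3 := Real.sin_sq_add_cos_sq |y|
            have e4 : (|y| * Real.cos |y|) ^ 2 ≤ Real.sin |y| ^ 2 := by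
              apply pow_le_pow_left₀ (by positivity) hlt2.le
            rw [← e1]
            rw [mul_pow, sq_abs] at e4
            nlinarith
          · exfalso
            apply h0
            rw [← Real.cos_abs, heq, Real.cos_pi_div_two]
      rw [hxy, Real.sin_two_mul]
      have hxy2 : x ^ 2 ≤ y ^ 2 := by
        rw [hy]
        have : (π * x / 2) ^ 2 = (π / 2) ^ 2 * x ^ 2 := by ring
        rw [this]
        have : 1 ≤ (π / 2) ^ 2 := by nlinarith
        nlinarith
      calc (2 * Real.sin y * Real.cos y) ^ 2 * (x ^ 2 + 1)
          = 4 * (Real.sin y ^ 2 * (Real.cos y ^ 2 * (x ^ 2 + 1))) := by ring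
        _ ≤ 4 * (y ^ 2 * (Real.cos y ^ 2 * (y ^ 2 + 1))) := by gcongr
        _ ≤ 4 * (y ^ 2 * 1) := by gcongr; exact hc0.2
        _ = (2 * y) ^ 2 := by ring
  have hpx : 0 < (π * x) ^ 2 := by have := pi_pos; positivity
  have h4 : (Real.sin (π * x) / (π * x)) ^ 2 ≤ 1 / (x ^ 2 + 1) := by
    rw [div_pow, div_le_div_iff₀ hpx (by positivity), one_mul]
    exact hmain
  have h5 : x ^ 2 / (x ^ 2 + 1) = 1 - 1 / (x ^ 2 + 1) := by field_simp; ring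
  rw [h5, pairCorKernel]
  linarith

lemma kernel_le_one (x : ℝ) : pairCorKernel x ≤ 1 := by
  rw [pairCorKernel]
  linarith [sq_nonneg (Real.sin (π * x) / (π * x))]

lemma kernel_nonneg (x : ℝ) : 0 ≤ pairCorKernel x := le_trans (by positivity) (kernel_ge x)

lemma integrable_mul_kernel {R : ℝ → ℝ} (hR : Integrable R) :
    Integrable (fun x => R x * pairCorKernel x) := by
  refine hR.mul_bdd (c := 1) ?_ ?_
  · apply Measurable.aestronglyMeasurable
    unfold pairCorKernel
    fun_prop
  · refine Eventually.of_forall fun x => ?_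
    rw [Real.norm_eq_abs, abs_of_nonneg (kernel_nonneg x)]
    exact kernel_le_one x

lemma exists_param_pos {ζ : ℂ} (hζ : ‖ζ‖ = 1) (him : 0 < ζ.im) {β : ℝ} (hβ : 0 < β) :
    ∃ a : ℝ, 0 ≤ a ∧ ζ * bl a β = 1 ∧ 2 * a / (β ^ 2 + a ^ 2) = ζ.im / β := by
  obtain ⟨c, d⟩ := ζ
  simp only at him
  have h1 : c ^ 2 + d ^ 2 = 1 := by
    have := Complex.sq_norm (⟨c, d⟩ : ℂ)
    rw [hζ, Complex.normSq_mk] at this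
    linarith
  have hc : 0 < 1 - c := by nlinarith
  have ha : 0 < β * (1 - c) / d := by positivity
  refine ⟨β * (1 - c) / d, ha.le, ?_, ?_⟩
  · have hne := ofReal_add_mul_I_ne ha.ne' β
    rw [bl_eq ha, ← mul_div_assoc, div_eq_one_iff_eq hne]
    apply Complex.ext
    · simp
      field_simp
      ring
    · simp
      field_simp
      linear_combination h1
  · have : β ^ 2 + (β * (1 - c) / d) ^ 2 = β ^ 2 * (2 * (1 - c)) / d ^ 2 := by
      field_simp
      linear_combination h1
    rw [this]
    field_simp

lemma exists_param {ζ : ℂ} (hζ : ‖ζ‖ = 1) {β : ℝ} (hβ : 0 < β) :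
    ∃ a : ℝ, 0 ≤ a ∧ ∃ s : ℂ, (s = 1 ∨ s = -1) ∧ s * (ζ * bl a β) = 1 ∧
      2 * a / (β ^ 2 + a ^ 2) = |ζ.im| / β := by
  rcases lt_trichotomy ζ.im 0 with h | h | h
  · obtain ⟨a, ha, h1, h2⟩ := exists_param_pos (ζ := -ζ) (by simpa using hζ) (by simpa using h) hβ
    refine ⟨a, ha, -1, Or.inr rfl, ?_, ?_⟩
    · linear_combination h1
    · rw [h2, abs_of_neg h]; simp
  · refine ⟨0, le_rfl, ?_⟩
    have hz : ζ = ((ζ.re : ℝ) : ℂ) := by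
      apply Complex.ext <;> simp [h]
    rw [hz, Complex.norm_real, Real.norm_eq_abs] at hζ
    refine ⟨ζ, ?_, ?_, by simp [h]⟩
    · rcases abs_eq (zero_le_one' ℝ) |>.1 hζ with h1 | h1
      · left; rw [hz, h1]; simp
      · right; rw [hz, h1]; simp
    · have : ζ.re * ζ.re = 1 := by
        rw [← abs_mul_abs_self, hζ]; norm_num
      have hb : bl 0 β = 1 := by simp [bl]
      rw [hb, mul_one, hz]
      exact_mod_cast this
  · obtain ⟨a, ha, h1, h2⟩ := exists_param_pos hζ h hβ
    exact ⟨a, ha, 1, Or.inl rfl, by rw [one_mul, h1], by rw [h2, abs_of_pos h]⟩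

/-- The inner function before normalisation. -/
noncomputable def Th (a x : ℝ) : ℂ := cexp (2 * π * x * I) * bl 1 x * bl a x

lemma norm_exp2 (x : ℝ) : ‖cexp (2 * π * x * I)‖ = 1 := by
  simpa using norm_cexp_aux 1 x

lemma norm_Th {a : ℝ} (ha : 0 ≤ a) (x : ℝ) : ‖Th a x‖ = 1 := by
  rw [Th, norm_mul, norm_mul, norm_exp2, norm_bl zero_le_one, norm_bl ha]; norm_num

lemma continuous_Th {a : ℝ} (ha : 0 ≤ a) : Continuous (Th a) := by
  unfold Th
  have h1 := continuous_bl (zero_le_one' ℝ)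
  have h2 := continuous_bl ha
  fun_prop

lemma Th_neg (a x : ℝ) : Th a (-x) = (starRingEnd ℂ) (Th a x) := by
  rw [Th, Th, bl_neg, bl_neg, map_mul, map_mul, ← Complex.exp_conj]
  congr 3
  simp [map_ofNat]

lemma deriv_Th {a : ℝ} (ha : 0 ≤ a) (x : ℝ) :
    ∃ d : ℂ, HasDerivAt (Th a) d x ∧ ‖d‖ ≤ 2 * π + 2 / (x ^ 2 + 1) + 2 * a / (x ^ 2 + a ^ 2) := by
  have h1 : HasDerivAt (fun x : ℝ => cexp (2 * π * x * I)) (cexp (2 * π * x * I) * (2 * π * I)) x := by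
    have h0 : HasDerivAt (fun y : ℝ => (2 * π * y * I : ℂ)) (2 * π * I) x := by
      have := ((Complex.ofRealCLM.hasDerivAt (x := x)).const_mul (2 * π : ℂ)).mul_const I
      simpa using this
    exact h0.cexp
  have h := (h1.mul (hasDerivAt_bl (zero_le_one' ℝ))).mul (hasDerivAt_bl (x := x) ha)
  refine ⟨_, h, ?_⟩
  refine (norm_add_le _ _).trans ?_
  rw [norm_mul, norm_mul, norm_bl ha, norm_deriv_bl ha, mul_one]
  gcongr
  · refine (norm_add_le _ _).trans ?_
    rw [norm_mul, norm_mul _ (_ / _), norm_bl zero_le_one, norm_deriv_bl zero_le_one, norm_exp2,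
      norm_mul, norm_exp2]
    simp [abs_of_pos pi_pos]
  · simp only [Pi.mul_apply, norm_mul, norm_exp2, norm_bl zero_le_one]
    simp

lemma kap_sq (x : ℝ) : (1 - I * (x + I : ℂ)⁻¹) * (1 - I * (x + I : ℂ)⁻¹) =
    ((x ^ 2 / (x ^ 2 + 1) : ℝ) : ℂ) * bl 1 x := by
  rw [bl_eq one_pos]
  have h1 : (x + I : ℂ) ≠ 0 := by simpa using ofReal_add_mul_I_ne one_ne_zero x
  have h2 : (x - I : ℂ) ≠ 0 := by
    simpa [sub_eq_add_neg] using ofReal_add_mul_I_ne (a := -1) (by norm_num) x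
  have h3 : ((x : ℂ) ^ 2 + 1) = (x + I) * (x - I) := by
    linear_combination Complex.I_mul_I
  push_cast
  rw [h3, one_mul]
  field_simp
  ring

lemma lower_bound {R : ℝ → ℝ} {β : ℝ} (hβ : 1 ≤ β) (hR : R ∈ OmegaClass β) :
    2 * (1 - |Real.sin (2 * π * β) / (2 * π * β)|) - 4 / β ^ 2 ≤ Mpc R := by
  obtain ⟨⟨hI, F, hFd, hFt, hFR⟩, hR0, hRp, hRm⟩ := hR
  have hβ0 : 0 < β := by linarith
  have hVR : Vanish (fun x : ℝ => (R x : ℂ)) := by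
    refine ⟨hI.ofReal, fun τ hτ => ?_⟩
    have := integral_mul_exp_eq_zero hFd hFt (by simp_rw [hFR]; exact hI.ofReal) hτ
    simpa [hFR] using this
  have hRc : Continuous R := by
    have : R = fun x : ℝ => (F x).re := by ext x; rw [hFR, Complex.ofReal_re]
    rw [this]
    exact Complex.continuous_re.comp (hFd.continuous.comp Complex.continuous_ofReal)
  set ζ : ℂ := cexp (2 * π * β * I) * bl 1 β with hζ
  have hζ1 : ‖ζ‖ = 1 := by rw [hζ, norm_mul, norm_exp2, norm_bl zero_le_one, mul_one]
  obtain ⟨a, ha, s, hs, hsζ, haβ⟩ := exists_param hζ1 hβ0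
  have hs1 : ‖s‖ = 1 := by rcases hs with rfl | rfl <;> simp
  have hsc : (starRingEnd ℂ) s = s := by rcases hs with rfl | rfl <;> simp
  have hq : s * Th a β = 1 := hsζ
  have hp : s * Th a (-β) = 1 := by
    rw [Th_neg, ← hsc, ← map_mul, hq, map_one]
  -- bound on the imaginary part
  have him : |ζ.im| ≤ |Real.sin (2 * π * β)| + 2 / β := by
    have e1 : (cexp (2 * π * β * I)).im = Real.sin (2 * π * β) := by
      have : (2 * π * β * I : ℂ) = ((2 * π * β : ℝ) : ℂ) * I := by push_cast; ring
      rw [this, Complex.exp_ofReal_mul_I_im]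
    have e2 : ‖ζ - cexp (2 * π * β * I)‖ ≤ 2 / β := by
      have : ζ - cexp (2 * π * β * I) = cexp (2 * π * β * I) * (-(2 * I * (β + I : ℂ)⁻¹)) := by
        rw [hζ, bl]; push_cast; ring
      rw [this, norm_mul, norm_exp2, norm_neg, norm_mul, norm_inv]
      have h3 : β ≤ ‖(β + I : ℂ)‖ := by
        have := Complex.abs_re_le_norm (β + I : ℂ)
        simpa [abs_of_pos hβ0] using this
      have h4 : ‖(β + I : ℂ)‖⁻¹ ≤ β⁻¹ := by gcongr
      simp only [norm_mul, Complex.norm_I, Complex.norm_ofNat]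
      rw [div_eq_mul_inv]
      linarith
    have e3 : ζ.im = (cexp (2 * π * β * I)).im + (ζ - cexp (2 * π * β * I)).im := by
      rw [Complex.sub_im]; ring
    rw [e3, e1]
    exact (abs_add_le _ _).trans (add_le_add le_rfl ((Complex.abs_im_le_norm _).trans e2))
  have hV : ∀ n : ℕ, Vanish (fun x : ℝ => (R x : ℂ) * (1 - I * (x + I : ℂ)⁻¹) *
      (1 - I * (x + I : ℂ)⁻¹) * Th a x ^ n) := by
    intro n
    induction n with
    | zero => simpa using hVR.mul_kap.mul_kap
    | succ n ih =>
      have := (ih.mul_exp.mul_bl zero_le_one).mul_bl ha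
      convert this using 2 with x
      rw [pow_succ]
      simp only [Th]
      ring
  set f : ℝ → ℝ := fun x => R x * (x ^ 2 / (x ^ 2 + 1)) with hf
  have hu : ∀ x : ℝ, 0 ≤ x ^ 2 / (x ^ 2 + 1) ∧ x ^ 2 / (x ^ 2 + 1) ≤ 1 := fun x =>
    ⟨by positivity, (kernel_ge x).trans (kernel_le_one x)⟩
  have huc : Continuous (fun x : ℝ => x ^ 2 / (x ^ 2 + 1)) :=
    Continuous.div (by fun_prop) (by fun_prop) (fun x => by positivity)
  have hfI : Integrable f := by
    refine hI.mul_bdd (c := 1) huc.aestronglyMeasurable (Eventually.of_forall fun x => ?_)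
    rw [Real.norm_eq_abs, abs_of_nonneg (hu x).1]
    exact (hu x).2
  have hvan : ∀ n : ℕ, ∫ x : ℝ, (f x : ℂ) * (s * Th a x) ^ (n + 1) = 0 := by
    intro n
    have h1 := ((hV n).mul_bl ha).2 1 le_rfl
    have e : ∀ x : ℝ, (f x : ℂ) * (s * Th a x) ^ (n + 1) = s ^ (n + 1) *
        ((R x : ℂ) * (1 - I * (x + I : ℂ)⁻¹) * (1 - I * (x + I : ℂ)⁻¹) * Th a x ^ n * bl a x *
          cexp (2 * π * (1 : ℝ) * x * I)) := by
      intro x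
      have h2 := kap_sq x
      have h3 : (f x : ℂ) = (R x : ℂ) * ((x ^ 2 / (x ^ 2 + 1) : ℝ) : ℂ) := by
        rw [hf]; push_cast; rfl
      rw [h3, mul_pow, pow_succ (Th a x), Complex.ofReal_one, mul_one]
      conv_lhs => rw [show Th a x ^ n * Th a x = Th a x ^ n *
        (cexp (2 * π * x * I) * bl 1 x * bl a x) from rfl]
      linear_combination (-(s ^ (n + 1) * R x * Th a x ^ n * bl a x * cexp (2 * π * x * I))) * h2
    simp_rw [e]
    rw [integral_const_mul, h1, mul_zero]
  obtain ⟨d1, hd1, hb1⟩ := deriv_Th ha (-β)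
  obtain ⟨d2, hd2, hb2⟩ := deriv_Th ha β
  rw [neg_sq] at hb1
  rw [haβ] at hb1 hb2
  set S : ℝ := |Real.sin (2 * π * β) / (2 * π * β)| with hS
  have hS0 : 0 ≤ S := abs_nonneg _
  have hSe : |Real.sin (2 * π * β)| / β = 2 * π * S := by
    rw [hS, abs_div, abs_of_pos (show 0 < 2 * π * β by positivity)]
    field_simp
  set X : ℝ := 1 / β ^ 2 with hX
  have hX0 : 0 < X := by positivity
  have hX1 : X ≤ 1 := by
    rw [hX, div_le_one (by positivity)]; nlinarith
  have hDb : 2 * π + 2 / (β ^ 2 + 1) + |ζ.im| / β ≤ 2 * π + 2 * π * S + 4 * X := by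
    have h1 : 2 / (β ^ 2 + 1) ≤ 2 * X := by
      rw [hX, mul_one_div]; gcongr; linarith
    have h2 : |ζ.im| / β ≤ 2 * π * S + 2 * X := by
      calc |ζ.im| / β ≤ (|Real.sin (2 * π * β)| + 2 / β) / β := by gcongr
        _ = _ := by rw [add_div, hSe, hX]; field_simp
    linarith
  have hD : 0 < 2 * π + 2 * π * S + 4 * X := by have := pi_pos; positivity
  have htp := two_point hfI (hRc.mul huc) (fun x => mul_nonneg (hR0 x) (hu x).1)
    (Θ := fun x => s * Th a x) (continuous_const.mul (continuous_Th ha))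
    (fun x => by rw [norm_mul, hs1, norm_Th ha, one_mul]) hvan (p := -β) (q := β) (by linarith)
    (hd1.const_mul s) (hd2.const_mul s) hp hq hD
    (by rw [norm_mul, hs1, one_mul]; exact hb1.trans hDb)
    (by rw [norm_mul, hs1, one_mul]; exact hb2.trans hDb)
  have hM : ∫ x, f x ≤ Mpc R := by
    apply integral_mono hfI (integrable_mul_kernel hI)
    intro x
    exact mul_le_mul_of_nonneg_left (kernel_ge x) (hR0 x)
  refine le_trans ?_ (htp.trans hM)
  have hA : 1 - X ≤ β ^ 2 / (β ^ 2 + 1) := by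
    rw [hX, le_div_iff₀ (by positivity)]
    have : (1 - 1 / β ^ 2) * (β ^ 2 + 1) = β ^ 2 - 1 / β ^ 2 := by field_simp; ring
    rw [this]
    have : 0 < 1 / β ^ 2 := by positivity
    linarith
  have hB : 1 - S - X ≤ 2 * π / (2 * π + 2 * π * S + 4 * X) := by
    rw [le_div_iff₀ hD]
    have hpi := Real.pi_gt_three
    have h1 : 0 ≤ π * S * S := by positivity
    have h2 : 0 ≤ π * S * X := by positivity
    have h3 : 0 ≤ S * X := by positivity
    nlinarith [mul_nonneg hX0.le hX0.le, mul_nonneg hX0.le (sub_nonneg.2 hpi.le)]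
  have hB0 : 0 < 2 * π / (2 * π + 2 * π * S + 4 * X) := by have := pi_pos; positivity
  have hff : 2 * (1 - X) ≤ f (-β) + f β := by
    have hu0 := (hu β).1
    simp only [hf, neg_sq]
    nlinarith
  have h4X : 4 / β ^ 2 = 4 * X := by rw [hX]; ring
  rw [h4X]
  calc 2 * (1 - S) - 4 * X ≤ 2 * (1 - X) * (1 - S - X) := by nlinarith [mul_nonneg hS0 hX0.le]
    _ ≤ 2 * (1 - X) * (2 * π / (2 * π + 2 * π * S + 4 * X)) := by
        apply mul_le_mul_of_nonneg_left hB; linarith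
    _ ≤ _ := mul_le_mul_of_nonneg_right hff hB0.le

/-- The entire extension of `sin z / z`. -/
noncomputable def csinc : ℂ → ℂ := dslope Complex.sin 0

lemma csinc_of_ne {z : ℂ} (hz : z ≠ 0) : csinc z = Complex.sin z / z := by
  rw [csinc, dslope_of_ne _ hz, slope_def_field]; simp

lemma csinc_zero : csinc 0 = 1 := by
  rw [csinc, dslope_same]; simp [Complex.deriv_sin]

lemma differentiable_csinc : Differentiable ℂ csinc := by
  intro z
  have h := (Complex.differentiableOn_dslope (f := Complex.sin) (s := Set.univ) (c := 0)
    Filter.univ_mem).2 Complex.differentiable_sin.differentiableOn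
  exact (h z (Set.mem_univ z)).differentiableAt Filter.univ_mem

lemma csinc_ofReal (x : ℝ) : csinc x = (Real.sinc x : ℂ) := by
  rcases eq_or_ne x 0 with rfl | hx
  · simp [csinc_zero]
  · rw [csinc_of_ne (by exact_mod_cast hx), Real.sinc_of_ne_zero hx]
    push_cast; rfl

lemma norm_csin_le (z : ℂ) : ‖Complex.sin z‖ ≤ Real.exp ‖z‖ := by
  rw [Complex.sin, norm_div, norm_mul, Complex.norm_I, mul_one, Complex.norm_two]
  have h1 : ‖cexp (-z * I)‖ ≤ Real.exp ‖z‖ := by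
    simpa using Complex.norm_exp_le_exp_norm (-z * I)
  have h2 : ‖cexp (z * I)‖ ≤ Real.exp ‖z‖ := by
    simpa using Complex.norm_exp_le_exp_norm (z * I)
  have := norm_sub_le (cexp (-z * I)) (cexp (z * I))
  linarith

lemma csinc_bound : ∃ C > 0, ∀ z : ℂ, ‖csinc z‖ ≤ C * Real.exp ‖z‖ := by
  obtain ⟨C, hC⟩ := (isCompact_closedBall (0 : ℂ) 1).exists_bound_of_continuousOn
    differentiable_csinc.continuous.continuousOn
  refine ⟨max C 1, by positivity, fun z => ?_⟩
  rcases le_total ‖z‖ 1 with h | h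
  · calc ‖csinc z‖ ≤ C := hC z (by simpa using h)
      _ ≤ max C 1 * 1 := by rw [mul_one]; exact le_max_left _ _
      _ ≤ _ := by gcongr; exact Real.one_le_exp (norm_nonneg _)
  · have hz : z ≠ 0 := by rintro rfl; norm_num at h
    rw [csinc_of_ne hz, norm_div]
    calc ‖Complex.sin z‖ / ‖z‖ ≤ ‖Complex.sin z‖ := div_le_self (norm_nonneg _) h
      _ ≤ 1 * Real.exp ‖z‖ := by rw [one_mul]; exact norm_csin_le z
      _ ≤ _ := by gcongr; exact le_max_right _ _

/-- Shifted real sinc. -/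
noncomputable def ss (a x : ℝ) : ℝ := Real.sinc (π * (x - a))

lemma continuous_ss (a : ℝ) : Continuous (ss a) := by
  unfold ss
  exact Real.continuous_sinc.comp (by fun_prop)

/-- Entire version. -/
noncomputable def cs (a : ℝ) (z : ℂ) : ℂ := csinc (π * (z - a))

lemma cs_ofReal (a x : ℝ) : cs a x = (ss a x : ℂ) := by
  rw [cs, ss, ← csinc_ofReal]; push_cast; rfl

lemma differentiable_cs (a : ℝ) : Differentiable ℂ (cs a) :=
  differentiable_csinc.comp (by fun_prop)

lemma cs_bound (a : ℝ) : ∃ C > 0, ∀ z : ℂ, ‖cs a z‖ ≤ C * Real.exp (π * ‖z‖) := by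
  obtain ⟨C, hC, h⟩ := csinc_bound
  refine ⟨C * Real.exp (π * |a|), by positivity, fun z => (h _).trans ?_⟩
  rw [mul_assoc, ← Real.exp_add]
  gcongr
  rw [norm_mul, Complex.norm_real, Real.norm_eq_abs, abs_of_pos pi_pos, ← mul_add]
  gcongr
  have := norm_sub_le z a
  rw [Complex.norm_real, Real.norm_eq_abs] at this
  linarith

lemma expType_mul {f g : ℂ → ℂ} (hf : ∃ C > 0, ∀ z : ℂ, ‖f z‖ ≤ C * Real.exp (π * ‖z‖))
    (hg : ∃ C > 0, ∀ z : ℂ, ‖g z‖ ≤ C * Real.exp (π * ‖z‖)) :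
    HasExpTypeLE (fun z => f z * g z) (2 * π) := by
  obtain ⟨C, hC, h1⟩ := hf
  obtain ⟨D, hD, h2⟩ := hg
  intro ε hε
  refine ⟨C * D, by positivity, fun z => ?_⟩
  rw [norm_mul]
  calc ‖f z‖ * ‖g z‖ ≤ (C * Real.exp (π * ‖z‖)) * (D * Real.exp (π * ‖z‖)) := by
        gcongr; exacts [h1 z, h2 z]
    _ = C * D * Real.exp (2 * π * ‖z‖) := by
        rw [show 2 * π * ‖z‖ = π * ‖z‖ + π * ‖z‖ by ring, Real.exp_add]; ring
    _ ≤ _ := by gcongr; linarith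

lemma abs_sinc_mul_le (x : ℝ) : |Real.sinc x| * |x| ≤ 1 := by
  rcases eq_or_ne x 0 with rfl | hx
  · simp
  · rw [Real.sinc_of_ne_zero hx, ← abs_mul, div_mul_cancel₀ _ hx]
    exact Real.abs_sin_le_one x

lemma ss_sq_le (a x : ℝ) : ss a x ^ 2 ≤ 2 * (1 + (x - a) ^ 2)⁻¹ := by
  rw [← div_eq_mul_inv, le_div_iff₀ (by positivity)]
  have h1 := Real.abs_sinc_le_one (π * (x - a))
  have h2 := abs_sinc_mul_le (π * (x - a))
  have h3 : |Real.sinc (π * (x - a))| * |x - a| ≤ 1 := by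
    refine le_trans ?_ h2
    rw [abs_mul, abs_of_pos pi_pos]
    have := Real.pi_gt_three
    gcongr
    nlinarith [abs_nonneg (x - a)]
  have h4 : ss a x ^ 2 ≤ 1 := by
    rw [ss, ← sq_abs]; exact pow_le_one₀ (abs_nonneg _) h1
  have h5 : ss a x ^ 2 * (x - a) ^ 2 ≤ 1 := by
    rw [ss, ← mul_pow, ← sq_abs, abs_mul]; exact pow_le_one₀ (by positivity) h3
  linarith

lemma integrable_ss_sq (a : ℝ) : Integrable (fun x => ss a x ^ 2) := by
  have h := (integrable_inv_one_add_sq.comp_sub_right a).const_mul 2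
  refine h.mono' ((continuous_ss a).pow 2).aestronglyMeasurable (Eventually.of_forall fun x => ?_)
  rw [Real.norm_eq_abs, abs_of_nonneg (sq_nonneg _)]
  exact ss_sq_le a x

lemma integrable_ss_mul (a b : ℝ) : Integrable (fun x => ss a x * ss b x) := by
  refine ((integrable_ss_sq a).add (integrable_ss_sq b)).mono'
    ((continuous_ss a).mul (continuous_ss b)).aestronglyMeasurable (Eventually.of_forall fun x => ?_)
  rw [Real.norm_eq_abs, abs_le]
  simp only [Pi.add_apply]
  constructor <;> nlinarith [sq_nonneg (ss a x + ss b x), sq_nonneg (ss a x - ss b x),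
    sq_nonneg (ss a x), sq_nonneg (ss b x)]

lemma ss_isBigO (a : ℝ) : (fun x => ss a x) =O[cocompact ℝ] (fun x => |x|⁻¹) := by
  apply Asymptotics.IsBigO.of_bound 1
  have h : ∀ᶠ x : ℝ in cocompact ℝ, 2 * |a| + 1 ≤ ‖x‖ :=
    (tendsto_norm_cocompact_atTop (E := ℝ)).eventually_ge_atTop _
  filter_upwards [h] with x hx
  rw [Real.norm_eq_abs] at hx
  have ha := abs_nonneg a
  have hx0 : 0 < |x| := by linarith
  rw [norm_inv, Real.norm_eq_abs, Real.norm_eq_abs, abs_abs, one_mul, ← one_div, le_div_iff₀ hx0]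
  refine le_trans ?_ (abs_sinc_mul_le (π * (x - a)))
  rw [ss]
  refine mul_le_mul_of_nonneg_left ?_ (abs_nonneg _)
  rw [abs_mul, abs_of_pos pi_pos]
  have h1 := abs_sub_abs_le_abs_sub x a
  have := Real.pi_gt_three
  nlinarith

lemma ss_int (a : ℝ) {n : ℤ} (hn : n ≠ 0) : ss a (a + n) = 0 := by
  have : (n : ℝ) ≠ 0 := by exact_mod_cast hn
  have h2 : π * (a + n - a) ≠ 0 := by rw [add_sub_cancel_left]; positivity
  rw [ss, Real.sinc_of_ne_zero h2, add_sub_cancel_left, mul_comm, Real.sin_int_mul_pi, zero_div]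

lemma ss_self (a : ℝ) : ss a a = 1 := by simp [ss]

open FourierTransform in
lemma integral_ss_mul (a b : ℝ) : ∫ x, ss a x * ss b x = ss b a := by
  set f : ℝ → ℂ := fun x => ((ss a x * ss b x : ℝ) : ℂ) with hf
  have hfc : Continuous f := by
    rw [hf]; exact Complex.continuous_ofReal.comp ((continuous_ss a).mul (continuous_ss b))
  have hfO : f =O[cocompact ℝ] (fun x : ℝ => |x| ^ (-(2:ℝ))) := by
    have h := (ss_isBigO a).mul (ss_isBigO b)
    have h2 : f =O[cocompact ℝ] (fun x => ss a x * ss b x) :=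
      Asymptotics.isBigO_of_le _ (fun x => by rw [hf, Complex.norm_real])
    refine (h2.trans h).congr_right fun x => ?_
    rw [Real.rpow_neg (abs_nonneg x), Real.rpow_two, sq, mul_inv]
  have hvan : ∀ t : ℝ, 1 ≤ |t| → 𝓕 f t = 0 := by
    intro t ht
    have hT := expType_mul (cs_bound a) (cs_bound b)
    have hD := (differentiable_cs a).mul (differentiable_cs b)
    rw [Real.fourier_eq']
    rcases le_abs.1 ht with h | h
    · have := integral_mul_exp_eq_zero (F := fun z => cs a (-z) * cs b (-z)) (by
          exact hD.comp differentiable_neg) (by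
          intro ε hε
          obtain ⟨C, hC, h⟩ := hT ε hε
          exact ⟨C, hC, fun z => by simpa using h (-z)⟩) (by
          have := (integrable_ss_mul a b).comp_neg.ofReal (𝕜 := ℂ)
          refine this.congr (Eventually.of_forall fun x => ?_)
          simp only [← Complex.ofReal_neg, cs_ofReal]; push_cast; rfl) h
      rw [← this, ← integral_neg_eq_self]
      congr 1
      ext x
      simp only [← Complex.ofReal_neg, cs_ofReal, hf, smul_eq_mul]
      rw [mul_comm]
      congr 1
      · push_cast; rfl
      · congr 1
        simp
        ring
    · have := integral_mul_exp_eq_zero (F := fun z => cs a z * cs b z) hD hT (by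
          have := (integrable_ss_mul a b).ofReal (𝕜 := ℂ)
          refine this.congr (Eventually.of_forall fun x => ?_)
          simp only [cs_ofReal]; push_cast; rfl) h
      rw [← this]
      congr 1
      ext x
      simp only [cs_ofReal, hf, smul_eq_mul]
      rw [mul_comm]
      congr 1
      · push_cast; rfl
      · congr 1
        simp
        ring
  have hFO : (𝓕 f) =O[cocompact ℝ] (fun x : ℝ => |x| ^ (-(2:ℝ))) := by
    have h0 : (𝓕 f) =ᶠ[cocompact ℝ] fun _ => 0 := by
      have h : ∀ᶠ x : ℝ in cocompact ℝ, 1 ≤ ‖x‖ :=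
        (tendsto_norm_cocompact_atTop (E := ℝ)).eventually_ge_atTop _
      filter_upwards [h] with x hx
      exact hvan x hx
    exact h0.trans_isBigO (Asymptotics.isBigO_zero _ _)
  have hP := Real.tsum_eq_tsum_fourier_of_rpow_decay hfc (b := 2) (by norm_num) hfO hFO a
  rw [tsum_eq_single 0, tsum_eq_single 0] at hP
  · have h0 : 𝓕 f ((0 : ℤ) : ℝ) = ∫ x, f x := by
      rw [Real.fourier_eq']; simp
    rw [h0] at hP
    simp only [hf, Int.cast_zero, add_zero, ss_self, one_mul, fourier_zero, mul_one] at hP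
    have hO : ∫ x, ((ss a x * ss b x : ℝ) : ℂ) = ((∫ x, ss a x * ss b x : ℝ) : ℂ) :=
      integral_ofReal
    exact (Complex.ofReal_injective (hP.trans hO)).symm
  · intro n hn
    rw [hvan, zero_mul]
    rw [← Int.cast_abs]
    exact_mod_cast Int.one_le_abs hn
  · intro n hn
    simp [hf, ss_int a hn]

lemma upper_bound {β : ℝ} (hβ : 1 ≤ β) : ∃ R ∈ OmegaClass β,
    Mpc R ≤ 2 * (1 - |Real.sin (2 * π * β) / (2 * π * β)|) + 4 / β ^ 2 := by
  set S : ℝ := Real.sin (2 * π * β) / (2 * π * β) with hS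
  have hβ0 : 0 < β := by linarith
  have h2 : 0 < 2 * π * β := by have := pi_pos; positivity
  have hS1 : ss (-β) β = S := by
    rw [ss, show π * (β - -β) = 2 * π * β by ring, Real.sinc_of_ne_zero h2.ne']
  have hS2 : ss β (-β) = S := by
    rw [ss, show π * (-β - β) = -(2 * π * β) by ring, Real.sinc_neg, Real.sinc_of_ne_zero h2.ne']
  obtain ⟨σ, hσ, hσS⟩ : ∃ σ : ℝ, σ * σ = 1 ∧ σ * S = |S| := by
    rcases abs_cases S with ⟨h, -⟩ | ⟨h, -⟩
    · exact ⟨1, by norm_num, by rw [h, one_mul]⟩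
    · exact ⟨-1, by norm_num, by rw [h, neg_one_mul]⟩
  have hA : 0 ≤ |S| := abs_nonneg S
  set c : ℝ := ((1 + |S|) ^ 2)⁻¹ with hc
  have hc0 : 0 < c := by positivity
  have hcc : c * (1 + |S|) ^ 2 = 1 := inv_mul_cancel₀ (by positivity)
  set g : ℝ → ℝ := fun x => ss β x + σ * ss (-β) x with hg
  have hexp : ∀ x, c * (g x * g x) = c * (ss β x * ss β x) +
      (2 * σ * c) * (ss β x * ss (-β) x) + c * (ss (-β) x * ss (-β) x) := by
    intro x
    simp only [hg]
    linear_combination c * ss (-β) x * ss (-β) x * hσ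
  have hi1 := (integrable_ss_mul β β).const_mul c
  have hi2 := (integrable_ss_mul β (-β)).const_mul (2 * σ * c)
  have hi3 := (integrable_ss_mul (-β) (-β)).const_mul c
  have hRI : Integrable (fun x => c * (g x * g x)) := by
    simp_rw [hexp]
    exact (hi1.add hi2).add hi3
  have hRint : ∫ x, c * (g x * g x) = c * (2 * (1 + |S|)) := by
    simp_rw [hexp]
    have hi12 : Integrable (fun x => c * (ss β x * ss β x) +
        (2 * σ * c) * (ss β x * ss (-β) x)) := hi1.add hi2
    rw [integral_add hi12 hi3, integral_add hi1 hi2, integral_const_mul,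
      integral_const_mul, integral_const_mul, integral_ss_mul, integral_ss_mul, integral_ss_mul,
      ss_self, ss_self, hS1]
    linear_combination 2 * c * hσS
  refine ⟨fun x => c * (g x * g x), ⟨⟨hRI, ?_⟩, ?_, ?_, ?_⟩, ?_⟩
  · set G : ℂ → ℂ := fun z => cs β z + σ * cs (-β) z with hG
    have hGd : Differentiable ℂ G := (differentiable_cs β).add ((differentiable_cs (-β)).const_mul _)
    have hGb : ∃ C > 0, ∀ z : ℂ, ‖G z‖ ≤ C * Real.exp (π * ‖z‖) := by
      obtain ⟨C, hC, h1⟩ := cs_bound β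
      obtain ⟨D, hD, h2⟩ := cs_bound (-β)
      refine ⟨C + |σ| * D, by positivity, fun z => ?_⟩
      refine (norm_add_le _ _).trans ?_
      rw [norm_mul, Complex.norm_real, Real.norm_eq_abs, add_mul, mul_assoc]
      gcongr
      exacts [h1 z, h2 z]
    have hGb2 : ∃ C > 0, ∀ z : ℂ, ‖(c : ℂ) * G z‖ ≤ C * Real.exp (π * ‖z‖) := by
      obtain ⟨C, hC, h1⟩ := hGb
      refine ⟨c * C, by positivity, fun z => ?_⟩
      rw [norm_mul, Complex.norm_real, Real.norm_eq_abs, abs_of_pos hc0, mul_assoc]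
      gcongr
      exact h1 z
    refine ⟨fun z => ((c : ℂ) * G z) * G z, (hGd.const_mul _).mul hGd, expType_mul hGb2 hGb,
      fun x => ?_⟩
    simp only [hG, hg, cs_ofReal]
    push_cast
    ring
  · intro x
    have := mul_self_nonneg (g x)
    positivity
  · simp only [hg, ss_self, hS1, hσS]
    rw [← sq, hcc]
  · simp only [hg, ss_self, hS2]
    have : c * ((S + σ * 1) * (S + σ * 1)) = c * (1 + |S|) ^ 2 := by
      have hsq : S * S = |S| * |S| := (abs_mul_abs_self S).symm
      linear_combination c * hsq + c * hσ + 2 * c * hσS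
    rw [this, hcc]
  · have hle : Mpc (fun x => c * (g x * g x)) ≤ ∫ x, c * (g x * g x) := by
      apply integral_mono (integrable_mul_kernel hRI) hRI
      intro x
      have h := mul_self_nonneg (g x)
      exact mul_le_of_le_one_right (by positivity) (kernel_le_one x)
    refine hle.trans ?_
    rw [hRint]
    have hSβ : |S| * β ≤ 1 := by
      rw [hS, abs_div, abs_of_pos h2, div_mul_eq_mul_div, div_le_one h2]
      have := Real.abs_sin_le_one (2 * π * β)
      have := Real.pi_gt_three
      nlinarith
    have hS2' : |S| ^ 2 ≤ 1 / β ^ 2 := by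
      rw [le_div_iff₀ (by positivity), ← mul_pow]
      exact pow_le_one₀ (by positivity) hSβ
    have h5 : c * (2 * (1 + |S|)) ≤ 2 * (1 - |S|) + 2 * |S| ^ 2 := by
      have h6 : c * (2 * (1 + |S|)) = 2 / (1 + |S|) := by rw [hc]; field_simp
      rw [h6, div_le_iff₀ (by positivity)]
      nlinarith [pow_nonneg hA 3]
    have h7 : 4 / β ^ 2 = 4 * (1 / β ^ 2) := by ring
    have h8 : 0 < 1 / β ^ 2 := by positivity
    linarith

theorem two_delta_asymptotic :
    ∃ C > 0, ∃ β₀ > 0, ∀ β ≥ β₀,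
      |twoDelta β - 2 * (1 - |Real.sin (2 * π * β) / (2 * π * β)|)| ≤ C / β ^ 2 := by
  refine ⟨4, by norm_num, 1, one_pos, fun β hβ => ?_⟩
  obtain ⟨R, hR, hM⟩ := upper_bound hβ
  have h1 : twoDelta β ≤ Mpc R := by
    refine csInf_le ⟨2 * (1 - |Real.sin (2 * π * β) / (2 * π * β)|) - 4 / β ^ 2, ?_⟩ (Set.mem_image_of_mem _ hR)
    rintro _ ⟨Q, hQ, rfl⟩
    exact lower_bound hβ hQ
  have h2 : 2 * (1 - |Real.sin (2 * π * β) / (2 * π * β)|) - 4 / β ^ 2 ≤ twoDelta β := by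
    refine le_csInf ⟨_, Set.mem_image_of_mem _ hR⟩ ?_
    rintro _ ⟨Q, hQ, rfl⟩
    exact lower_bound hβ hQ
  rw [abs_le]
  constructor <;> linarith
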